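/- arXiv:math/0605162 — 3 statements merged into one kernel-verified Lean document; each statement's English description precedes it below -/
import Mathlib

section
/- Let 1 < c < 2. There is a constant C = C(c) such that for all real X, X₁, δ with 2 ≤ X < X₁ ≤ 2X and 0 < δ < 1/4, the number S_δ of integers n with X < n ≤ X₁ and ‖n^c‖ < δ satisfies S_δ ≤ C · (δ(X₁ − X) + δ^{-1/2} X^{c/2}). -/
/-- The additive character `x ↦ exp (2πix)` on the reals. -/
noncomputable def unitExp (x : ℝ) : ℂ := Complex.exp ((2 * Real.pi * x : ℝ) * Complex.I)

lemma norm_unitExp (x : ℝ) : ‖unitExp x‖ = 1 := Complex.norm_exp_ofReal_mul_I _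

lemma unitExp_add (x y : ℝ) : unitExp (x + y) = unitExp x * unitExp y := by
  rw [unitExp, unitExp, unitExp, ← Complex.exp_add]
  congr 1
  push_cast
  ring

lemma unitExp_intCast (k : ℤ) : unitExp k = 1 := by
  rw [unitExp, ← Complex.exp_int_mul_two_pi_mul_I k]
  congr 1
  push_cast
  ring

lemma unitExp_sub_intCast (x : ℝ) (k : ℤ) : unitExp (x - k) = unitExp x := by
  have h := unitExp_add (x - k) k
  rw [unitExp_intCast, mul_one, sub_add_cancel] at h
  exact h.symm

lemma conj_unitExp (x : ℝ) : (starRingEnd ℂ) (unitExp x) = unitExp (-x) := by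
  rw [unitExp, unitExp, ← Complex.exp_conj]
  congr 1
  rw [map_mul, Complex.conj_ofReal, Complex.conj_I]
  push_cast
  ring

lemma two_mul_le_sin_pi_mul {θ t : ℝ} (hθ : 0 < θ) (h1 : θ ≤ t) (h2 : t ≤ 1 - θ) :
    2 * θ ≤ Real.sin (Real.pi * t) := by
  have hpi := Real.pi_pos
  rcases le_total t (1 / 2) with h | h
  · have := Real.mul_le_sin (x := Real.pi * t) (mul_nonneg hpi.le (by linarith)) (by nlinarith)
    have e : 2 / Real.pi * (Real.pi * t) = 2 * t := by field_simp
    linarith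
  · have := Real.mul_le_sin (x := Real.pi * (1 - t)) (by apply mul_nonneg <;> linarith)
      (by nlinarith)
    have e : 2 / Real.pi * (Real.pi * (1 - t)) = 2 * (1 - t) := by field_simp
    have e' : Real.sin (Real.pi * (1 - t)) = Real.sin (Real.pi * t) := by
      rw [mul_sub, mul_one, Real.sin_pi_sub]
    linarith

lemma cos_div_sin_le {a b : ℝ} (ha : 0 < Real.sin a) (hb : 0 < Real.sin b) (hab : a ≤ b)
    (hba : b - a ≤ Real.pi) : Real.cos b / Real.sin b ≤ Real.cos a / Real.sin a := by
  rw [div_le_div_iff₀ hb ha]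
  have := Real.sin_nonneg_of_nonneg_of_le_pi (sub_nonneg.2 hab) hba
  rw [Real.sin_sub] at this
  linarith

lemma unitExp_eq_cot_mul {t : ℝ} (ht : Real.sin (Real.pi * t) ≠ 0) :
    (-(1 + (Real.cos (Real.pi * t) / Real.sin (Real.pi * t) : ℝ) * Complex.I) / 2)
      * (unitExp t - 1) = 1 := by
  have h : unitExp t = (Real.cos (Real.pi * t) + Real.sin (Real.pi * t) * Complex.I) ^ 2 := by
    rw [unitExp, Complex.ofReal_cos, Complex.ofReal_sin, ← Complex.exp_mul_I, ← Complex.exp_nat_mul]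
    congr 1
    push_cast
    ring
  have hcs : (Real.cos (Real.pi * t) : ℂ) ^ 2 + (Real.sin (Real.pi * t) : ℂ) ^ 2 = 1 := by
    exact_mod_cast Real.cos_sq_add_sin_sq (Real.pi * t)
  have hs : (Real.sin (Real.pi * t) : ℂ) ≠ 0 := by exact_mod_cast ht
  rw [h, Complex.ofReal_div]
  generalize (Real.cos (Real.pi * t) : ℂ) = C at *
  generalize (Real.sin (Real.pi * t) : ℂ) = S at *
  have hI := Complex.I_sq
  field_simp
  have hC : C ^ 2 = 1 - S ^ 2 := by linear_combination hcs
  have e : (C + S * Complex.I) ^ 2 - 1 = 2 * S * Complex.I * (C + S * Complex.I) := by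
    linear_combination hcs - S ^ 2 * hI
  rw [e]
  linear_combination (-2 * S * C ^ 2 - 2 * S ^ 2 * C * Complex.I) * hI + 2 * S * hcs - 2 * S ^ 3 * hI

/-- Kusmin–Landau inequality. -/
theorem norm_sum_unitExp_le_of_monotone_diff (y : ℕ → ℝ) (k : ℤ) {θ : ℝ} (hθ : 0 < θ) (M : ℕ)
    (hmono : ∀ n, n + 1 < M → y (n + 1) - y n ≤ y (n + 2) - y (n + 1))
    (hlow : ∀ n < M, k + θ ≤ y (n + 1) - y n) (hup : ∀ n < M, y (n + 1) - y n ≤ k + 1 - θ) :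
    ‖∑ n ∈ Finset.range M, unitExp (y n)‖ ≤ 1 / θ := by
  rcases Nat.eq_zero_or_pos M with rfl | hM
  · simpa using hθ.le
  set t : ℕ → ℝ := fun n => y (n + 1) - y n - k with ht
  set r : ℕ → ℝ := fun n => Real.cos (Real.pi * t n) / Real.sin (Real.pi * t n) with hr
  set w : ℕ → ℂ := fun n => -(1 + (r n : ℂ) * Complex.I) / 2 with hw
  have hsin : ∀ n < M, 2 * θ ≤ Real.sin (Real.pi * t n) := fun n hn =>
    two_mul_le_sin_pi_mul hθ (by have := hlow n hn; simp only [ht]; linarith)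
      (by have := hup n hn; simp only [ht]; linarith)
  have hrbound : ∀ n < M, |r n| ≤ 1 / (2 * θ) := by
    intro n hn
    have h := hsin n hn
    rw [hr, abs_div, abs_of_pos (by linarith : 0 < Real.sin (Real.pi * t n))]
    exact div_le_div₀ zero_le_one (Real.abs_cos_le_one _) (by positivity) h
  have hwE : ∀ n < M, w n * unitExp (y (n + 1)) - w n * unitExp (y n) = unitExp (y n) := by
    intro n hn
    have h := unitExp_eq_cot_mul (t := t n) (by have := hsin n hn; intro h0; linarith)
    have e : unitExp (y (n + 1)) = unitExp (y n) * unitExp (t n) := by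
      rw [ht, unitExp_sub_intCast, ← unitExp_add]
      congr 1
      ring
    rw [e]
    linear_combination unitExp (y n) * h
  have hwnorm : ∀ n < M, ‖w n‖ ≤ 1 / (4 * θ) := by
    intro n hn
    have h := hsin n hn
    have h0 : 0 < Real.sin (Real.pi * t n) := by linarith
    have h1 : ‖w n‖ ^ 2 = (1 / (2 * Real.sin (Real.pi * t n))) ^ 2 := by
      have e : w n = ((-1 / 2 : ℝ) : ℂ) + ((-(r n) / 2 : ℝ) : ℂ) * Complex.I := by
        simp only [hw]
        push_cast
        ring
      rw [← Complex.normSq_eq_norm_sq, e, Complex.normSq_add_mul_I]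
      simp only [hr]
      have := Real.cos_sq_add_sin_sq (Real.pi * t n)
      field_simp
      linarith
    rw [(sq_eq_sq₀ (norm_nonneg _) (by positivity)).1 h1]
    exact one_div_le_one_div_of_le (by positivity) (by linarith)
  have key : ∀ m < M, ‖∑ n ∈ Finset.range (m + 1), unitExp (y n) - w m * unitExp (y (m + 1))‖
      ≤ ‖w 0‖ + (r 0 - r m) / 2 := by
    intro m
    induction m with
    | zero =>
      intro h
      have e : ∑ n ∈ Finset.range (0 + 1), unitExp (y n) - w 0 * unitExp (y (0 + 1))
          = - (w 0 * unitExp (y 0)) := by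
        rw [zero_add, Finset.sum_range_one]
        linear_combination -hwE 0 h
      rw [e, norm_neg, norm_mul, norm_unitExp]
      simp
    | succ m ih =>
      intro h
      have ih := ih (by omega)
      have e : ∑ n ∈ Finset.range (m + 1 + 1), unitExp (y n)
            - w (m + 1) * unitExp (y (m + 1 + 1))
          = (∑ n ∈ Finset.range (m + 1), unitExp (y n) - w m * unitExp (y (m + 1)))
            + (w m - w (m + 1)) * unitExp (y (m + 1)) := by
        rw [Finset.sum_range_succ _ (m + 1)]
        linear_combination -hwE (m + 1) h
      have hle : r (m + 1) ≤ r m := by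
        have h1 := hmono m h
        have h2 := hlow m (by omega)
        have h3 := hup (m + 1) h
        have h4 := hsin m (by omega)
        have h5 := hsin (m + 1) h
        have hpi := Real.pi_pos
        refine cos_div_sin_le (by linarith) (by linarith) ?_ ?_
        · exact mul_le_mul_of_nonneg_left (by simp only [ht]; linarith) hpi.le
        · rw [← mul_sub]
          exact mul_le_of_le_one_right hpi.le (by simp only [ht]; linarith)
      have e2 : w m - w (m + 1) = (((r m - r (m + 1)) / 2 : ℝ) : ℂ) * (-Complex.I) := by
        simp only [hw]
        push_cast
        ring
      have e3 : ‖(w m - w (m + 1)) * unitExp (y (m + 1))‖ = (r m - r (m + 1)) / 2 := by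
        rw [norm_mul, norm_unitExp, mul_one, e2, norm_mul, norm_neg, Complex.norm_I, mul_one,
          Complex.norm_real, Real.norm_of_nonneg (by linarith)]
      rw [e]
      refine (norm_add_le _ _).trans ?_
      rw [e3]
      linarith
  obtain ⟨m, rfl⟩ : ∃ m, M = m + 1 := ⟨M - 1, by omega⟩
  have h1 := key m (by omega)
  have h2 := hwnorm m (by omega)
  have h3 := hwnorm 0 (by omega)
  have h4 := abs_le.1 (hrbound 0 (by omega))
  have h5 := abs_le.1 (hrbound m (by omega))
  have h6 : ‖w m * unitExp (y (m + 1))‖ = ‖w m‖ := by rw [norm_mul, norm_unitExp, mul_one]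
  have h7 := norm_le_norm_sub_add (∑ n ∈ Finset.range (m + 1), unitExp (y n))
    (w m * unitExp (y (m + 1)))
  have e1 : 1 / (2 * θ) = 1 / θ / 2 := by field_simp
  have e2 : 1 / (4 * θ) = 1 / θ / 4 := by field_simp
  linarith

lemma card_le_of_separated {d : ℕ → ℝ} {s : Finset ℕ} {μ θ u : ℝ} (hμ : 0 < μ) (hθ : 0 ≤ θ)
    (hsep : ∀ i ∈ s, ∀ j ∈ s, i ≤ j → μ * ((j : ℝ) - i) ≤ d j - d i)
    (hlow : ∀ i ∈ s, u ≤ d i) (hup : ∀ i ∈ s, d i ≤ u + θ) : (s.card : ℝ) ≤ θ / μ + 1 := by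
  rcases s.eq_empty_or_nonempty with rfl | hs
  · simp only [Finset.card_empty, Nat.cast_zero]
    positivity
  have hab : s.min' hs ≤ s.max' hs := s.min'_le_max' hs
  have hsub : s ⊆ Finset.Icc (s.min' hs) (s.max' hs) := fun i hi =>
    Finset.mem_Icc.2 ⟨s.min'_le i hi, s.le_max' i hi⟩
  have hcard : s.card + s.min' hs ≤ s.max' hs + 1 := by
    have h := Finset.card_le_card hsub
    rw [Nat.card_Icc] at h
    omega
  have hcard' : (s.card : ℝ) + (s.min' hs : ℕ) ≤ (s.max' hs : ℕ) + 1 := by exact_mod_cast hcard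
  have h1 := hsep _ (s.min'_mem hs) _ (s.max'_mem hs) hab
  have h2 := hlow _ (s.min'_mem hs)
  have h3 := hup _ (s.max'_mem hs)
  have h4 : ((s.max' hs : ℕ) : ℝ) - (s.min' hs : ℕ) ≤ θ / μ := by
    rw [le_div_iff₀ hμ]
    linarith
  linarith

lemma norm_sum_unitExp_le_card (x : ℕ → ℝ) (s : Finset ℕ) :
    ‖∑ n ∈ s, unitExp (x n)‖ ≤ s.card :=
  (norm_sum_le _ _).trans_eq (by simp [norm_unitExp])

/-- The Kusmin–Landau inequality over the set of indices at which the differences of `x` lie in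
`[k + θ, k + 1 - θ]`. -/
lemma norm_sum_filter_unitExp_le {x : ℕ → ℝ} {N : ℕ} (k : ℤ) {θ : ℝ} (hθ : 0 < θ)
    (hmono : ∀ i j, i ≤ j → j ≤ N → x (i + 1) - x i ≤ x (j + 1) - x j)
    {s : Finset ℕ}
    (hs : ∀ n, n ∈ s ↔ n < N ∧ k + θ ≤ x (n + 1) - x n ∧ x (n + 1) - x n ≤ k + 1 - θ) :
    ‖∑ n ∈ s, unitExp (x n)‖ ≤ 1 / θ := by
  rcases s.eq_empty_or_nonempty with rfl | hne
  · simpa using hθ.le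
  obtain ⟨a, ha⟩ : ∃ a, a = s.min' hne := ⟨_, rfl⟩
  obtain ⟨b, hb⟩ : ∃ b, b = s.max' hne := ⟨_, rfl⟩
  have has := (hs a).1 (ha ▸ s.min'_mem hne)
  have hbs := (hs b).1 (hb ▸ s.max'_mem hne)
  have heq : s = Finset.Ico a (b + 1) := by
    ext n
    rw [Finset.mem_Ico, Nat.lt_succ_iff]
    refine ⟨fun hn => ⟨ha ▸ s.min'_le n hn, hb ▸ s.le_max' n hn⟩, fun ⟨h1, h2⟩ => ?_⟩
    have h3 := hmono a n h1 (by omega)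
    have h4 := hmono n b h2 (by omega)
    exact (hs n).2 ⟨by omega, by linarith, by linarith⟩
  have hmem : ∀ n < b + 1 - a, a + n ∈ s := fun n hn => by
    rw [heq, Finset.mem_Ico]
    omega
  rw [heq, Finset.sum_Ico_eq_sum_range]
  refine norm_sum_unitExp_le_of_monotone_diff (fun n => x (a + n)) k hθ _ ?_ ?_ ?_
  · intro n hn
    exact hmono (a + n) (a + n + 1) (by omega) (by omega)
  · intro n hn
    exact ((hs _).1 (hmem n hn)).2.1
  · intro n hn
    exact ((hs _).1 (hmem n hn)).2.2

/-- Van der Corput's second derivative test, in terms of second differences. -/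
theorem norm_sum_unitExp_le_of_second_diff (x : ℕ → ℝ) (N : ℕ) {μ : ℝ} (hμ : 0 < μ)
    (hlow : ∀ n < N, μ ≤ x (n + 2) - x (n + 1) - (x (n + 1) - x n))
    (hup : ∀ n < N, x (n + 2) - x (n + 1) - (x (n + 1) - x n) ≤ 3 * μ) :
    ‖∑ n ∈ Finset.range N, unitExp (x n)‖ ≤ 15 * (N * √μ + 1 / √μ) := by
  have hsq : 0 < √μ := Real.sqrt_pos.2 hμ
  have hsq2 : √μ * √μ = μ := Real.mul_self_sqrt hμ.le
  rcases lt_or_ge 1 μ with h1 | h1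
  · refine (norm_sum_unitExp_le_card x _).trans ?_
    rw [Finset.card_range]
    have h2 : (1 : ℝ) ≤ √μ := Real.one_le_sqrt.2 h1.le
    have h3 : 0 < 1 / √μ := by positivity
    have h4 : (0 : ℝ) ≤ N := Nat.cast_nonneg N
    nlinarith
  rcases Nat.eq_zero_or_pos N with rfl | hN
  · simp only [Finset.range_zero, Finset.sum_empty, norm_zero]
    positivity
  set d : ℕ → ℝ := fun n => x (n + 1) - x n with hd
  have hdiff : ∀ i j, i ≤ j → j ≤ N →
      μ * ((j : ℝ) - i) ≤ d j - d i ∧ d j - d i ≤ 3 * μ * ((j : ℝ) - i) := by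
    intro i j hij
    induction j, hij using Nat.le_induction with
    | base => simp
    | succ j hij ih =>
      intro hj
      have h1 := ih (by omega)
      have h2 : μ ≤ d (j + 1) - d j := hlow j (by omega)
      have h3 : d (j + 1) - d j ≤ 3 * μ := hup j (by omega)
      push_cast
      constructor <;> linarith [h1.1, h1.2]
  have hmono : ∀ i j, i ≤ j → j ≤ N → d i ≤ d j := by
    intro i j hij hj
    have h1 := (hdiff i j hij hj).1
    have h2 : (i : ℝ) ≤ j := by exact_mod_cast hij
    have h3 : 0 ≤ μ * ((j : ℝ) - i) := mul_nonneg hμ.le (by linarith)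
    linarith
  have hinv : 1 ≤ 1 / √μ := by
    rw [le_div_iff₀ hsq, one_mul]
    exact Real.sqrt_le_one.2 h1
  have hdiv : √μ / μ = 1 / √μ := by
    rw [div_eq_div_iff hμ.ne' hsq.ne', hsq2, one_mul]
  have hk : ∀ k : ℤ, ‖∑ n ∈ Finset.range N with ⌊d n⌋ = k, unitExp (x n)‖ ≤ 5 * (1 / √μ) := by
    intro k
    set s := (Finset.range N).filter (fun n => ⌊d n⌋ = k) with hs
    have hsmem : ∀ n, n ∈ s ↔ n < N ∧ (k : ℝ) ≤ d n ∧ d n < k + 1 := by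
      intro n
      rw [hs, Finset.mem_filter, Finset.mem_range, Int.floor_eq_iff]
    have hsep : ∀ t ⊆ s, ∀ i ∈ t, ∀ j ∈ t, i ≤ j → μ * ((j : ℝ) - i) ≤ d j - d i :=
      fun t ht i _ j hj hij => (hdiff i j hij ((hsmem j).1 (ht hj)).1.le).1
    rw [← Finset.sum_filter_add_sum_filter_not s (fun n => d n < k + √μ),
      ← Finset.sum_filter_add_sum_filter_not
        (s.filter (fun n => ¬ d n < k + √μ)) (fun n => (k : ℝ) + 1 - √μ < d n)]
    have hA : ‖∑ n ∈ s with d n < k + √μ, unitExp (x n)‖ ≤ 1 / √μ + 1 := by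
      refine (norm_sum_unitExp_le_card x _).trans ?_
      rw [← hdiv]
      refine card_le_of_separated (d := d) (u := k) hμ hsq.le
        (hsep _ (Finset.filter_subset _ _)) ?_ ?_
      · intro i hi
        exact ((hsmem i).1 (Finset.mem_filter.1 hi).1).2.1
      · intro i hi
        exact (Finset.mem_filter.1 hi).2.le
    have hB : ‖∑ n ∈ s.filter (fun n => ¬ d n < k + √μ) with (k : ℝ) + 1 - √μ < d n,
        unitExp (x n)‖ ≤ 1 / √μ + 1 := by
      refine (norm_sum_unitExp_le_card x _).trans ?_
      rw [← hdiv]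
      refine card_le_of_separated (d := d) (u := k + 1 - √μ) hμ hsq.le
        (hsep _ ((Finset.filter_subset _ _).trans (Finset.filter_subset _ _))) ?_ ?_
      · intro i hi
        exact (Finset.mem_filter.1 hi).2.le
      · intro i hi
        have := ((hsmem i).1 (Finset.mem_filter.1 (Finset.mem_filter.1 hi).1).1).2.2
        linarith
    have hC : ‖∑ n ∈ s.filter (fun n => ¬ d n < k + √μ) with ¬ (k : ℝ) + 1 - √μ < d n,
        unitExp (x n)‖ ≤ 1 / √μ := by
      refine norm_sum_filter_unitExp_le (N := N) k hsq hmono ?_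
      intro n
      rw [Finset.mem_filter, Finset.mem_filter, hsmem, not_lt, not_lt]
      constructor
      · rintro ⟨⟨h1, h2⟩, h3⟩
        exact ⟨h1.1, h2, h3⟩
      · rintro ⟨h1, h2, h3⟩
        exact ⟨⟨⟨h1, by linarith, by linarith⟩, h2⟩, h3⟩
    refine (norm_add_le _ _).trans ?_
    have := norm_add_le (∑ n ∈ s.filter (fun n => ¬ d n < k + √μ) with (k : ℝ) + 1 - √μ < d n,
        unitExp (x n)) (∑ n ∈ s.filter (fun n => ¬ d n < k + √μ) with ¬ (k : ℝ) + 1 - √μ < d n,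
        unitExp (x n))
    linarith
  have hmaps : ∀ n ∈ Finset.range N, ⌊d n⌋ ∈ Finset.Icc ⌊d 0⌋ ⌊d (N - 1)⌋ := by
    intro n hn
    rw [Finset.mem_range] at hn
    exact Finset.mem_Icc.2 ⟨Int.floor_mono (hmono 0 n (by omega) (by omega)),
      Int.floor_mono (hmono n (N - 1) (by omega) (by omega))⟩
  have hcard : ((Finset.Icc ⌊d 0⌋ ⌊d (N - 1)⌋).card : ℝ) ≤ 3 * μ * N + 2 := by
    have h0 := Int.floor_mono (hmono 0 (N - 1) (by omega) (by omega))
    have h2 : (((Finset.Icc ⌊d 0⌋ ⌊d (N - 1)⌋).card : ℤ) : ℝ)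
        = ((⌊d (N - 1)⌋ + 1 - ⌊d 0⌋ : ℤ) : ℝ) := by
      rw [Int.card_Icc, Int.toNat_of_nonneg (by omega)]
    rw [Int.cast_natCast] at h2
    rw [h2]
    push_cast
    have h3 := (hdiff 0 (N - 1) (by omega) (by omega)).2
    rw [Nat.cast_sub hN] at h3
    have h4 := Int.floor_le (d (N - 1))
    have h5 := Int.lt_floor_add_one (d 0)
    push_cast at h3
    nlinarith
  rw [← Finset.sum_fiberwise_of_maps_to hmaps]
  refine (norm_sum_le_of_le _ (fun k _ => hk k)).trans ?_
  rw [Finset.sum_const, nsmul_eq_mul]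
  calc _ ≤ (3 * μ * N + 2) * (5 * (1 / √μ)) := by gcongr
    _ = 15 * (N * √μ) + 10 * (1 / √μ) := by
      rw [← hdiv]
      field_simp
      nlinarith [hsq2]
    _ ≤ _ := by linarith

/-- Mean value theorem for the second differences of `t ↦ t ^ c`. -/
lemma exists_second_diff_rpow (c : ℝ) {t : ℝ} (ht : 0 < t) :
    ∃ ξ, t < ξ ∧ ξ < t + 2 ∧
      (t + 2) ^ c - (t + 1) ^ c - ((t + 1) ^ c - t ^ c) = c * (c - 1) * ξ ^ (c - 2) := by
  have hder : ∀ u : ℝ, 0 < u → HasDerivAt (fun v : ℝ => v ^ c) (c * u ^ (c - 1)) u :=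
    fun u hu => Real.hasDerivAt_rpow_const (Or.inl hu.ne')
  have hder1 : ∀ u : ℝ, 0 < u → HasDerivAt (fun v : ℝ => (v + 1) ^ c - v ^ c)
      (c * (u + 1) ^ (c - 1) - c * u ^ (c - 1)) u := fun u hu =>
    ((hder (u + 1) (by linarith)).comp_add_const u 1).sub (hder u hu)
  have hder2 : ∀ u : ℝ, 0 < u → HasDerivAt (fun v : ℝ => c * v ^ (c - 1))
      (c * ((c - 1) * u ^ (c - 1 - 1))) u := fun u hu =>
    (Real.hasDerivAt_rpow_const (Or.inl hu.ne')).const_mul c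
  obtain ⟨u, ⟨hu1, hu2⟩, hu⟩ := exists_hasDerivAt_eq_slope _ _ (lt_add_one t)
    (fun v hv => (hder1 v (ht.trans_le hv.1)).continuousAt.continuousWithinAt)
    (fun v hv => hder1 v (ht.trans hv.1))
  obtain ⟨ξ, ⟨h1, h2⟩, hξ⟩ := exists_hasDerivAt_eq_slope _ _ (lt_add_one u)
    (fun v hv => (hder2 v ((ht.trans hu1).trans_le hv.1)).continuousAt.continuousWithinAt)
    (fun v hv => hder2 v ((ht.trans hu1).trans hv.1))
  refine ⟨ξ, by linarith, by linarith, ?_⟩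
  rw [add_sub_cancel_left, div_one] at hu hξ
  rw [show c - 1 - 1 = c - 2 by ring] at hξ
  rw [show t + 1 + 1 = t + 2 by ring] at hu
  linarith

lemma second_diff_rpow_bounds {c X t : ℝ} (hc1 : 1 < c) (hc2 : c < 2) (hX : 2 ≤ X)
    (h1 : X ≤ t) (h2 : t ≤ 2 * X) :
    c * (c - 1) / 3 * X ^ (c - 2) ≤ (t + 2) ^ c - (t + 1) ^ c - ((t + 1) ^ c - t ^ c) ∧
    (t + 2) ^ c - (t + 1) ^ c - ((t + 1) ^ c - t ^ c)
      ≤ 3 * (c * (c - 1) / 3 * X ^ (c - 2)) := by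
  obtain ⟨ξ, hξ1, hξ2, e⟩ := exists_second_diff_rpow c (t := t) (by linarith)
  have hcc : 0 < c * (c - 1) := mul_pos (by linarith) (by linarith)
  rw [e]
  constructor
  · have h3 : (3 * X) ^ (c - 2) ≤ ξ ^ (c - 2) :=
      Real.rpow_le_rpow_of_nonpos (by linarith) (by linarith) (by linarith)
    rw [Real.mul_rpow (by norm_num) (by linarith)] at h3
    have h4 : (3 : ℝ) ^ (-1 : ℝ) ≤ 3 ^ (c - 2) :=
      Real.rpow_le_rpow_of_exponent_le (by norm_num) (by linarith)
    rw [Real.rpow_neg_one] at h4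
    have h5 : 0 < X ^ (c - 2) := Real.rpow_pos_of_pos (by linarith) _
    calc _ = c * (c - 1) * (3⁻¹ * X ^ (c - 2)) := by ring
      _ ≤ c * (c - 1) * (3 ^ (c - 2) * X ^ (c - 2)) := by gcongr
      _ ≤ _ := by gcongr
  · have h3 : ξ ^ (c - 2) ≤ X ^ (c - 2) :=
      Real.rpow_le_rpow_of_nonpos (by linarith) (by linarith) (by linarith)
    calc _ ≤ c * (c - 1) * X ^ (c - 2) := by gcongr
      _ = _ := by ring

/-- Detecting points close to an integer through the Fejér kernel. -/
lemma sq_div_four_le_normSq_sum_unitExp {H : ℕ} {y : ℝ} (hy : |y - round y| * (8 * H) ≤ 1) :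
    (H : ℝ) ^ 2 / 4 ≤ ‖∑ h ∈ Finset.range H, unitExp (h * y)‖ ^ 2 := by
  have hre : ∀ h ∈ Finset.range H, 1 / 2 ≤ (unitExp (h * y)).re := by
    intro h hh
    have hhH : (h : ℝ) ≤ H := by exact_mod_cast (Finset.mem_range.1 hh).le
    have e : unitExp (h * y) = unitExp (h * (y - round y)) := by
      rw [← unitExp_sub_intCast (h * y) (h * round y)]
      congr 1
      push_cast
      ring
    rw [e, unitExp, Complex.exp_ofReal_mul_I_re, ← Real.cos_abs, ← Real.cos_pi_div_three]
    have hpi := Real.pi_pos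
    have h1 : |2 * Real.pi * (h * (y - round y))| ≤ Real.pi / 3 := by
      rw [abs_mul, abs_of_pos (by positivity : 0 < 2 * Real.pi), abs_mul, Nat.abs_cast]
      have h2 : (h : ℝ) * |y - round y| ≤ 1 / 8 := by
        have := mul_le_mul_of_nonneg_right hhH (abs_nonneg (y - round y))
        linarith
      nlinarith
    exact Real.cos_le_cos_of_nonneg_of_le_pi (abs_nonneg _) (by linarith) h1
  have h1 : (H : ℝ) / 2 ≤ ‖∑ h ∈ Finset.range H, unitExp (h * y)‖ := by
    refine le_trans ?_ (Complex.re_le_norm _)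
    rw [Complex.re_sum]
    refine le_trans ?_ (Finset.card_nsmul_le_sum _ _ _ hre)
    rw [Finset.card_range, nsmul_eq_mul]
    linarith
  calc (H : ℝ) ^ 2 / 4 = (H / 2) ^ 2 := by ring
    _ ≤ _ := by gcongr

lemma sum_normSq_sum_unitExp_le {ι : Type*} (s : Finset ι) (y : ι → ℝ) (H : ℕ) {B : ℝ}
    (hB0 : 0 ≤ B)
    (hB : ∀ h : ℕ, 1 ≤ h → h < H → ‖∑ n ∈ s, unitExp (h * y n)‖ ≤ B) :
    ∑ n ∈ s, ‖∑ h ∈ Finset.range H, unitExp (h * y n)‖ ^ 2 ≤ H * s.card + H ^ 2 * B := by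
  have hB' : ∀ i ∈ Finset.range H, ∀ j ∈ Finset.range H,
      ‖∑ n ∈ s, unitExp (((i : ℝ) - j) * y n)‖ ≤ (if i = j then (s.card : ℝ) else 0) + B := by
    intro i hi j hj
    rw [Finset.mem_range] at hi hj
    rcases lt_trichotomy i j with h | h | h
    · have e : ∑ n ∈ s, unitExp (((i : ℝ) - j) * y n)
          = (starRingEnd ℂ) (∑ n ∈ s, unitExp (((j - i : ℕ) : ℝ) * y n)) := by
        rw [map_sum]
        refine Finset.sum_congr rfl fun n _ => ?_
        rw [conj_unitExp, Nat.cast_sub h.le]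
        congr 1
        ring
      rw [e, RCLike.norm_conj, if_neg h.ne, zero_add]
      exact hB _ (by omega) (by omega)
    · rw [if_pos h]
      refine (norm_sum_le _ _).trans ?_
      simp [norm_unitExp, hB0]
    · rw [if_neg h.ne', zero_add, ← Nat.cast_sub h.le]
      exact hB _ (by omega) (by omega)
  have e : ((∑ n ∈ s, ‖∑ h ∈ Finset.range H, unitExp (h * y n)‖ ^ 2 : ℝ) : ℂ)
      = ∑ i ∈ Finset.range H, ∑ j ∈ Finset.range H,
        ∑ n ∈ s, unitExp (((i : ℝ) - j) * y n) := by
    push_cast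
    rw [Finset.sum_congr rfl fun i _ => Finset.sum_comm, Finset.sum_comm]
    refine Finset.sum_congr rfl fun n _ => ?_
    rw [← Complex.mul_conj', map_sum, Finset.sum_mul_sum]
    refine Finset.sum_congr rfl fun i _ => Finset.sum_congr rfl fun j _ => ?_
    rw [conj_unitExp, ← unitExp_add]
    congr 1
    ring
  calc _ = ‖((∑ n ∈ s, ‖∑ h ∈ Finset.range H, unitExp (h * y n)‖ ^ 2 : ℝ) : ℂ)‖ := by
        rw [Complex.norm_real, Real.norm_of_nonneg (Finset.sum_nonneg fun _ _ => sq_nonneg _)]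
    _ ≤ ∑ i ∈ Finset.range H, ∑ j ∈ Finset.range H,
        ((if i = j then (s.card : ℝ) else 0) + B) := by
      rw [e]
      exact norm_sum_le_of_le _ fun i hi => norm_sum_le_of_le _ fun j hj => hB' i hi j hj
    _ = _ := by
      simp only [Finset.sum_add_distrib, Finset.sum_const, Finset.card_range, nsmul_eq_mul]
      rw [Finset.sum_congr rfl fun i hi => by rw [Finset.sum_ite_eq, if_pos hi]]
      rw [Finset.sum_const, Finset.card_range, nsmul_eq_mul]
      ring

/-- Fejér-kernel bound for the number of points close to an integer. -/
lemma card_near_integer_le {ι : Type*} (s t : Finset ι) (hts : t ⊆ s) (y : ι → ℝ) {H : ℕ}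
    (hH : 0 < H) (hy : ∀ n ∈ t, |y n - round (y n)| * (8 * H) ≤ 1) {B : ℝ} (hB0 : 0 ≤ B)
    (hB : ∀ h : ℕ, 1 ≤ h → h < H → ‖∑ n ∈ s, unitExp (h * y n)‖ ≤ B) :
    (t.card : ℝ) ≤ 4 * (s.card / H + B) := by
  have h1 : (t.card : ℝ) * ((H : ℝ) ^ 2 / 4) ≤ H * s.card + H ^ 2 * B := by
    refine le_trans ?_ (sum_normSq_sum_unitExp_le s y H hB0 hB)
    refine le_trans ?_ (Finset.sum_le_sum_of_subset_of_nonneg hts fun _ _ _ => sq_nonneg _)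
    rw [← nsmul_eq_mul]
    exact Finset.card_nsmul_le_sum _ _ _ fun n hn => sq_div_four_le_normSq_sum_unitExp (hy n hn)
  have hH' : (0 : ℝ) < H := by exact_mod_cast hH
  rw [← le_div_iff₀ (by positivity)] at h1
  refine h1.trans_eq ?_
  field_simp

lemma sum_Ioc_int_eq_sum_range {M : Type*} [AddCommMonoid M] (F : ℤ → M) (a b : ℤ) :
    ∑ n ∈ Finset.Ioc a b, F n = ∑ i ∈ Finset.range (b - a).toNat, F (a + 1 + i) := by
  symm
  refine Finset.sum_bij (fun i _ => a + 1 + (i : ℤ)) ?_ ?_ ?_ ?_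
  · intro i hi
    rw [Finset.mem_range] at hi
    rw [Finset.mem_Ioc]
    omega
  · intro i _ j _ h
    omega
  · intro n hn
    rw [Finset.mem_Ioc] at hn
    exact ⟨(n - a - 1).toNat, Finset.mem_range.2 (by omega), by omega⟩
  · intro i _
    rfl

/-- The second derivative test applied to `n ↦ h * n ^ c`. -/
lemma norm_sum_unitExp_rpow_le {c X X₁ : ℝ} (hc1 : 1 < c) (hc2 : c < 2) (hX : 2 ≤ X)
    (hX₁ : X₁ ≤ 2 * X) {h : ℕ} (hh : 1 ≤ h) :
    ‖∑ n ∈ Finset.Ioc ⌊X⌋ ⌊X₁⌋, unitExp (h * (n : ℝ) ^ c)‖ ≤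
      15 * (((Finset.Ioc ⌊X⌋ ⌊X₁⌋).card : ℝ) * √(h * (c * (c - 1) / 3 * X ^ (c - 2)))
        + 1 / √(h * (c * (c - 1) / 3 * X ^ (c - 2)))) := by
  have hh' : (0 : ℝ) < h := by exact_mod_cast hh
  have hX0 : 0 < X ^ (c - 2) := Real.rpow_pos_of_pos (by linarith) _
  have hcc : 0 < c * (c - 1) := mul_pos (by linarith) (by linarith)
  have hbounds : ∀ n < (⌊X₁⌋ - ⌊X⌋).toNat,
      X ≤ (⌊X⌋ : ℝ) + 1 + n ∧ (⌊X⌋ : ℝ) + 1 + n ≤ 2 * X := by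
    intro n hn
    have h1 := Int.lt_floor_add_one X
    have h2 := Int.floor_le X₁
    have h3 : ⌊X⌋ + 1 + (n : ℤ) ≤ ⌊X₁⌋ := by omega
    have h4 : (⌊X⌋ : ℝ) + 1 + n ≤ ⌊X₁⌋ := by exact_mod_cast h3
    have h5 : (0 : ℝ) ≤ n := Nat.cast_nonneg n
    constructor <;> linarith
  rw [sum_Ioc_int_eq_sum_range, Int.card_Ioc]
  have key : ∀ n : ℕ, (h : ℝ) * ((⌊X⌋ + 1 + ((n + 2 : ℕ) : ℤ) : ℤ) : ℝ) ^ c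
        - h * ((⌊X⌋ + 1 + ((n + 1 : ℕ) : ℤ) : ℤ) : ℝ) ^ c
        - (h * ((⌊X⌋ + 1 + ((n + 1 : ℕ) : ℤ) : ℤ) : ℝ) ^ c
          - h * ((⌊X⌋ + 1 + (n : ℤ) : ℤ) : ℝ) ^ c)
      = h * (((⌊X⌋ : ℝ) + 1 + n + 2) ^ c - ((⌊X⌋ : ℝ) + 1 + n + 1) ^ c
        - (((⌊X⌋ : ℝ) + 1 + n + 1) ^ c - ((⌊X⌋ : ℝ) + 1 + n) ^ c)) := by
    intro n
    push_cast
    rw [← add_assoc, ← add_assoc]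
    ring
  refine norm_sum_unitExp_le_of_second_diff
    (fun n : ℕ => (h : ℝ) * ((⌊X⌋ + 1 + (n : ℤ) : ℤ) : ℝ) ^ c) _ (by positivity) ?_ ?_
  · intro n hn
    obtain ⟨h1, h2⟩ := hbounds n hn
    refine le_of_le_of_eq ?_ (key n).symm
    exact mul_le_mul_of_nonneg_left (second_diff_rpow_bounds hc1 hc2 hX h1 h2).1 hh'.le
  · intro n hn
    obtain ⟨h1, h2⟩ := hbounds n hn
    refine (key n).trans_le ?_
    have := mul_le_mul_of_nonneg_left (second_diff_rpow_bounds hc1 hc2 hX h1 h2).2 hh'.le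
    linarith

open scoped Classical in
/-- For `1 < c < 2`, the number of integers `X < n ≤ X₁ ≤ 2X` with `‖n^c‖ < δ`
is at most `C (δ(X₁ - X) + δ^{-1/2} X^{c/2})`. -/
theorem count_near_integer_powers (c : ℝ) (hc1 : 1 < c) (hc2 : c < 2) :
    ∃ C : ℝ, ∀ X X₁ δ : ℝ, 2 ≤ X → X < X₁ → X₁ ≤ 2 * X → 0 < δ → δ < 1 / 4 →
      ((((Finset.Ioc ⌊X⌋ ⌊X₁⌋).filter
          (fun n : ℤ => |(n : ℝ) ^ c - round ((n : ℝ) ^ c)| < δ)).card : ℝ) ≤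
        C * (δ * (X₁ - X) + δ ^ (-(1 : ℝ) / 2) * X ^ (c / 2))) := by
  have hκ : 0 < c * (c - 1) / 3 := div_pos (mul_pos (by linarith) (by linarith)) (by norm_num)
  set κ : ℝ := c * (c - 1) / 3 with hκdef
  have hsκ : 0 < √κ := Real.sqrt_pos.2 hκ
  have hisκ : 0 < 1 / √κ := by positivity
  refine ⟨64 + 120 * √κ + 60 * (1 / √κ), fun X X₁ δ hX hXX hX₁ hδ hδ4 => ?_⟩
  have hX0 : 0 < X := by linarith
  set s := Finset.Ioc ⌊X⌋ ⌊X₁⌋ with hs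
  set t := s.filter (fun n : ℤ => |(n : ℝ) ^ c - round ((n : ℝ) ^ c)| < δ) with ht
  have hscard : (s.card : ℝ) ≤ X₁ - X + 1 := by
    have h0 := Int.floor_mono hXX.le
    have h2 : ((s.card : ℤ) : ℝ) = ((⌊X₁⌋ - ⌊X⌋ : ℤ) : ℝ) := by
      rw [hs, Int.card_Ioc, Int.toNat_of_nonneg (by omega)]
    rw [Int.cast_natCast] at h2
    rw [h2]
    push_cast
    linarith [Int.floor_le X₁, Int.lt_floor_add_one X]
  have hXc : 1 ≤ X ^ (c / 2) := Real.one_le_rpow (by linarith) (by linarith)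
  have hδrpow : δ ^ (-(1 : ℝ) / 2) = 1 / √δ := by
    rw [neg_div, Real.rpow_neg hδ.le, Real.sqrt_eq_rpow, one_div (δ ^ _)]
  have hsδ : 0 < √δ := Real.sqrt_pos.2 hδ
  have hδ1 : 1 ≤ 1 / √δ := by
    rw [le_div_iff₀ hsδ, one_mul]
    exact Real.sqrt_le_one.2 (by linarith)
  rw [hδrpow]
  set P := 1 / √δ * X ^ (c / 2) with hP
  have hXP : X ^ (c / 2) ≤ P := le_mul_of_one_le_left (by linarith) hδ1
  have hD : 0 < δ * (X₁ - X) := mul_pos hδ (by linarith)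
  suffices h : (t.card : ℝ) ≤ 64 * (δ * (X₁ - X)) + (16 + 120 * √κ + 60 * (1 / √κ)) * P by
    nlinarith [mul_pos hsκ hD, mul_pos hisκ hD]
  rcases lt_or_ge (1 / 8) δ with hδ8 | hδ8
  · have h1 : (t.card : ℝ) ≤ s.card := by exact_mod_cast Finset.card_filter_le _ _
    nlinarith [mul_pos hsκ (by linarith : 0 < P), mul_pos hisκ (by linarith : 0 < P)]
  set H := ⌊1 / (8 * δ)⌋₊ with hH
  have hdiv1 : 1 ≤ 1 / (8 * δ) := by
    rw [le_div_iff₀ (by positivity)]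
    linarith
  have hH0 : 0 < H := Nat.floor_pos.2 hdiv1
  have hH1 : (1 : ℝ) ≤ H := by exact_mod_cast hH0
  have hHle : (H : ℝ) * (8 * δ) ≤ 1 := by
    rw [← le_div_iff₀ (by positivity)]
    exact Nat.floor_le (by positivity)
  have hHge : 1 ≤ H * (16 * δ) := by
    have h1 : 1 / (8 * δ) < H + 1 := Nat.lt_floor_add_one _
    rw [div_lt_iff₀ (by positivity)] at h1
    nlinarith
  have hsX : √(κ * X ^ (c - 2)) = √κ * X ^ (c / 2 - 1) := by
    rw [Real.sqrt_mul hκ.le, Real.sqrt_eq_rpow (X ^ (c - 2)), ← Real.rpow_mul hX0.le]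
    congr 2
    ring
  have hXpos : 0 < X ^ (c / 2 - 1) := Real.rpow_pos_of_pos hX0 _
  have hXmul : X * X ^ (c / 2 - 1) = X ^ (c / 2) := by
    rw [← Real.rpow_one_add' hX0.le (by linarith)]
    congr 1
    ring
  have hXinv : 1 / X ^ (c / 2 - 1) ≤ X ^ (c / 2) := by
    rw [one_div, ← Real.rpow_neg hX0.le]
    exact Real.rpow_le_rpow_of_exponent_le (by linarith) (by linarith)
  have hsH : √(H : ℝ) ≤ 1 / √δ := by
    rw [le_div_iff₀ hsδ, ← Real.sqrt_mul (by positivity)]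
    refine Real.sqrt_le_one.2 ?_
    nlinarith
  have hB : ∀ h : ℕ, 1 ≤ h → h < H → ‖∑ n ∈ s, unitExp (h * (n : ℝ) ^ c)‖
      ≤ 15 * (2 * √κ * P + 1 / √κ * P) := by
    intro h hh hhH
    refine (norm_sum_unitExp_rpow_le hc1 hc2 hX hX₁ hh).trans ?_
    rw [← hκdef, Real.sqrt_mul (Nat.cast_nonneg h), hsX]
    have hh1 : 1 ≤ √(h : ℝ) := Real.one_le_sqrt.2 (by exact_mod_cast hh)
    have hhH' : √(h : ℝ) ≤ 1 / √δ :=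
      (Real.sqrt_le_sqrt (by exact_mod_cast hhH.le)).trans hsH
    refine mul_le_mul_of_nonneg_left (add_le_add ?_ ?_) (by norm_num)
    · calc (s.card : ℝ) * (√(h : ℝ) * (√κ * X ^ (c / 2 - 1)))
          ≤ (2 * X) * (1 / √δ * (√κ * X ^ (c / 2 - 1))) := by
            gcongr
            linarith
        _ = 2 * √κ * (1 / √δ * (X * X ^ (c / 2 - 1))) := by ring
        _ = 2 * √κ * P := by rw [hXmul]
    · calc 1 / (√(h : ℝ) * (√κ * X ^ (c / 2 - 1))) ≤ 1 / (√κ * X ^ (c / 2 - 1)) := by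
            apply one_div_le_one_div_of_le (by positivity)
            exact le_mul_of_one_le_left (by positivity) hh1
        _ = 1 / √κ * (1 / X ^ (c / 2 - 1)) := by rw [one_div_mul_one_div]
        _ ≤ 1 / √κ * P := by
            gcongr
            exact hXinv.trans hXP
  have hP0 : 0 < P := by linarith
  have hcount := card_near_integer_le s t (Finset.filter_subset _ _) (fun n : ℤ => (n : ℝ) ^ c)
    hH0 (fun n hn => ?_) (by positivity) hB
  · have h1 : (s.card : ℝ) / H ≤ 16 * (δ * (X₁ - X)) + 4 * P := by
      rw [div_le_iff₀ (by linarith)]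
      nlinarith
    linarith
  · have h1 := (Finset.mem_filter.1 hn).2
    have h2 : (0 : ℝ) < 8 * H := by linarith
    nlinarith
end

section
/- Let 1 < c < 3/2 and γ = 1/c. For every sufficiently large real N the following holds. Set η = (log N)^{-2}, N₁ = (1 + η)N, X = (N/2)^γ, X₁ = (1 + η)X, and δ = γ X^{1−c}. Let n be an integer with N < n ≤ N₁ and let p be a prime with X < p ≤ X₁ satisfying 4η < {p^c} < 1 − 4η and 1 − δ − ηδ < {(n − p^c)^γ} < 1 − δ + ηδ. Then there exists a positive integer m with ⌊m^c⌋ + ⌊p^c⌋ = n. -/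
/-- The graph of `x ↦ x ^ c` with `1 ≤ c` lies above its tangent at `a > 0`. -/
theorem rpow_tangent_le {a b c : ℝ} (hc : 1 ≤ c) (ha : 0 < a) (hb : 0 ≤ b) :
    a ^ c + c * a ^ (c - 1) * (b - a) ≤ b ^ c := by
  have hbern : 1 + c * (b / a - 1) ≤ (1 + (b / a - 1)) ^ c :=
    one_add_mul_self_le_rpow_one_add (by linarith [div_nonneg hb ha.le]) hc
  rw [add_sub_cancel, Real.div_rpow hb ha.le, le_div_iff₀ (by positivity)] at hbern
  refine le_of_eq_of_le ?_ hbern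
  rw [Real.rpow_sub_one ha.ne']
  field_simp

/-- If `w` exceeds `n - z` by an amount in `(1 - a, 1 + a)` and `a < fract z < 1 - a`,
then `w` has integer part `n - ⌊z⌋`. -/
theorem floor_add_floor_eq_of_near_one {n : ℤ} {w z a : ℝ} (hl : 1 - a < w - (n - z))
    (hu : w - (n - z) < 1 + a) (hz : a < Int.fract z) (hz' : Int.fract z < 1 - a) :
    ⌊w⌋ + ⌊z⌋ = n := by
  have hfl : ⌊w⌋ = n - ⌊z⌋ := by
    rw [Int.floor_eq_iff]
    push_cast
    constructor <;> linarith [Int.floor_add_fract z]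
  omega

/-- For `0 < γ`, the quantity `(N / 2) ^ γ` eventually dominates `2 * (log N) ^ 2`. -/
theorem eventually_two_mul_log_sq_le_rpow {γ : ℝ} (hγ : 0 < γ) :
    ∀ᶠ N : ℝ in Filter.atTop, 2 * Real.log N ^ 2 ≤ (N / 2) ^ γ := by
  have ho := isLittleO_log_rpow_rpow_atTop (2 : ℝ) hγ
  have hb := ho.bound (show (0 : ℝ) < (2 * 2 ^ γ)⁻¹ by positivity)
  filter_upwards [hb, Filter.eventually_gt_atTop 1] with N hN h1
  have hlog := Real.log_pos h1
  rw [Real.norm_of_nonneg (by positivity), Real.norm_of_nonneg (by positivity),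
    Real.rpow_two, inv_mul_eq_div, le_div_iff₀ (by positivity)] at hN
  rw [Real.div_rpow (by linarith) (by norm_num), le_div_iff₀ (by positivity)]
  linarith

/-- A nonnegative number at most `(1 + 3η) X` has `(c - 1)`-th power at most
`(1 + 3η / 2) X ^ (c - 1)`, for `1 < c < 3 / 2`. -/
theorem rpow_sub_one_le_of_le {c η X m : ℝ} (hc1 : 1 < c) (hc2 : c < 3 / 2) (hη : 0 < η)
    (hX : 0 < X) (hm : 0 ≤ m) (hmX : m ≤ (1 + 3 * η) * X) :
    m ^ (c - 1) ≤ (1 + 3 / 2 * η) * X ^ (c - 1) := by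
  calc m ^ (c - 1) ≤ ((1 + 3 * η) * X) ^ (c - 1) := by gcongr
    _ = (1 + 3 * η) ^ (c - 1) * X ^ (c - 1) := Real.mul_rpow (by positivity) hX.le
    _ ≤ (1 + 3 / 2 * η) * X ^ (c - 1) := by
      gcongr
      have := rpow_one_add_le_one_add_mul_self (s := 3 * η) (p := c - 1)
        (by linarith) (by linarith) (by linarith)
      nlinarith

/-- A real number at least `b * X` with `0 < b ≤ 1` has `r`-th power at least `b * X ^ r`,
for `0 < r ≤ 1`. -/
theorem mul_rpow_le_rpow {b r X y : ℝ} (hr : 0 < r) (hr1 : r ≤ 1) (hb : 0 < b) (hb1 : b ≤ 1)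
    (hX : 0 < X) (hy : b * X ≤ y) : b * X ^ r ≤ y ^ r := by
  calc b * X ^ r ≤ b ^ r * X ^ r := by
        gcongr
        exact Real.self_le_rpow_of_le_one hb.le hb1 hr1
    _ = (b * X) ^ r := (Real.mul_rpow hb.le hX.le).symm
    _ ≤ y ^ r := by gcongr

/-- If `y` is within a factor `1 + O(η)` of `X` and `t` is within a factor `1 + η` of `δ`,
where `c δ X ^ (c - 1) = 1`, then `(y + t) ^ c - y ^ c` is within `4 η` of `1`. -/
theorem near_one_rpow_add_sub_rpow {c η X y δ t : ℝ} (hc1 : 1 < c) (hc2 : c < 3 / 2)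
    (hη0 : 0 < η) (hη1 : η < 1 / 16) (hX0 : 0 < X) (hy0 : 0 < y) (hδ0 : 0 < δ)
    (hδX : c * (δ * X ^ (c - 1)) = 1) (hyl : (1 - 3 * η) * X ≤ y) (hyu : y ≤ (1 + 2 * η) * X)
    (htl : (1 - η) * δ < t) (htu : t < (1 + η) * δ) (htX : t ≤ η * X) :
    1 - 4 * η < (y + t) ^ c - y ^ c ∧ (y + t) ^ c - y ^ c < 1 + 4 * η := by
  have ht0 : 0 < t := lt_trans (mul_pos (by linarith) hδ0) htl
  constructor
  · have htan := rpow_tangent_le (b := y + t) hc1.le hy0 (by linarith)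
    have hpow := mul_rpow_le_rpow (r := c - 1) (by linarith) (by linarith)
      (by linarith : (0 : ℝ) < 1 - 3 * η) (by linarith) hX0 hyl
    have hmul : c * ((1 - 3 * η) * X ^ (c - 1)) * ((1 - η) * δ) ≤ c * y ^ (c - 1) * t := by
      have : 0 ≤ (1 - η) * δ := mul_nonneg (by linarith) hδ0.le
      gcongr
    have heq : c * ((1 - 3 * η) * X ^ (c - 1)) * ((1 - η) * δ) = (1 - 3 * η) * (1 - η) := by
      linear_combination (1 - 3 * η) * (1 - η) * hδX
    rw [add_sub_cancel_left] at htan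
    have hquad : 1 - 4 * η < (1 - 3 * η) * (1 - η) := by linarith [mul_pos hη0 hη0]
    linarith
  · have htan := rpow_tangent_le (a := y + t) hc1.le (by linarith) hy0.le
    have hpow := rpow_sub_one_le_of_le (m := y + t) hc1 hc2 hη0 hX0 (by linarith) (by linarith)
    have hmul : c * (y + t) ^ (c - 1) * t ≤
        c * ((1 + 3 / 2 * η) * X ^ (c - 1)) * ((1 + η) * δ) := by
      gcongr
    have heq : c * ((1 + 3 / 2 * η) * X ^ (c - 1)) * ((1 + η) * δ) =
        (1 + 3 / 2 * η) * (1 + η) := by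
      linear_combination (1 + 3 / 2 * η) * (1 + η) * hδX
    have hquad : (1 + 3 / 2 * η) * (1 + η) < 1 + 4 * η := by
      linarith [mul_lt_mul_of_pos_left hη1 hη0]
    linarith

/-- For `1 < c < 3/2`, `γ = 1/c`, and sufficiently large real `N`: with
`η = (log N)⁻²`, `N₁ = (1+η)N`, `X = (N/2)^γ`, `X₁ = (1+η)X`, `δ = γ X^{1-c}`,
any integer `n ∈ (N, N₁]` and prime `p ∈ (X, X₁]` with `4η < {p^c} < 1 - 4η` and
`1 - δ - ηδ < {(n - p^c)^γ} < 1 - δ + ηδ` give a positive integer `m` with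
`⌊m^c⌋ + ⌊p^c⌋ = n`. -/
theorem good_prime_gives_representation_short_interval (c γ : ℝ) (hc1 : 1 < c)
    (hc2 : c < 3 / 2) (hγ : γ = 1 / c) :
    ∀ᶠ N : ℝ in Filter.atTop, ∀ η N₁ X X₁ δ : ℝ,
      η = ((Real.log N) ^ 2)⁻¹ → N₁ = (1 + η) * N → X = (N / 2) ^ γ →
      X₁ = (1 + η) * X → δ = γ * X ^ (1 - c) →
      ∀ n : ℤ, N < (n : ℝ) → (n : ℝ) ≤ N₁ →
      ∀ p : ℕ, p.Prime → X < (p : ℝ) → (p : ℝ) ≤ X₁ →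
      4 * η < Int.fract ((p : ℝ) ^ c) → Int.fract ((p : ℝ) ^ c) < 1 - 4 * η →
      1 - δ - η * δ < Int.fract (((n : ℝ) - (p : ℝ) ^ c) ^ γ) →
      Int.fract (((n : ℝ) - (p : ℝ) ^ c) ^ γ) < 1 - δ + η * δ →
      ∃ m : ℕ, 0 < m ∧ ⌊(m : ℝ) ^ c⌋ + ⌊(p : ℝ) ^ c⌋ = n := by
  have hγ0 : 0 < γ := by rw [hγ]; positivity
  have hγ1 : γ ≤ 1 := by rw [hγ, div_le_one (by linarith)]; exact hc1.le
  have hcγ : c * γ = 1 := by rw [hγ]; field_simp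
  filter_upwards [eventually_two_mul_log_sq_le_rpow hγ0, Filter.eventually_gt_atTop 2,
    Real.tendsto_log_atTop.eventually_gt_atTop 4] with N hlogN hN2 hlog4
  rintro η N₁ X X₁ δ hη rfl hX rfl hδ n hn hn₁ p - hpX hpX₁ hf hf' hg hg'
  have hη0 : 0 < η := by rw [hη]; positivity
  have hη1 : η < 1 / 16 := by
    rw [hη, inv_lt_comm₀ (by positivity) (by norm_num)]
    nlinarith
  have hηX : 2 ≤ η * X := by
    rw [hη, hX, inv_mul_eq_div, le_div_iff₀ (by positivity)]
    exact hlogN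
  have hX1 : 1 < X := by nlinarith
  have hX0 : 0 < X := by linarith
  have hXc : X ^ c = N / 2 := by
    rw [hX, ← Real.rpow_mul (by linarith), mul_comm, hcγ, Real.rpow_one]
  have hXγ : (X ^ c) ^ γ = X := by rw [← Real.rpow_mul hX0.le, hcγ, Real.rpow_one]
  have hδX : c * (δ * X ^ (c - 1)) = 1 := by
    rw [hδ, mul_assoc, ← Real.rpow_add hX0]
    simp [hcγ]
  have hδ0 : 0 < δ := by rw [hδ]; positivity
  have hδ1 : δ ≤ 1 := by
    have : X ^ (1 - c) ≤ 1 := Real.rpow_le_one_of_one_le_of_nonpos hX1.le (by linarith)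
    have h0 : 0 ≤ X ^ (1 - c) := by positivity
    rw [hδ]
    nlinarith
  have hpc : X ^ c < (p : ℝ) ^ c := by gcongr
  have hpc' : (p : ℝ) ^ c ≤ (1 + 3 * η) * X ^ c := by
    calc (p : ℝ) ^ c ≤ ((1 + η) * X) ^ c := by gcongr
      _ = (1 + η) ^ c * X ^ c := Real.mul_rpow (by linarith) hX0.le
      _ ≤ (1 + 3 * η) * X ^ c := by
        gcongr
        calc (1 + η) ^ c ≤ (1 + η) ^ (2 : ℝ) :=
              Real.rpow_le_rpow_of_exponent_le (by linarith) (by linarith)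
          _ ≤ 1 + 3 * η := by rw [Real.rpow_two]; nlinarith
  set Y : ℝ := (n : ℝ) - (p : ℝ) ^ c with hY
  have hYl : (1 - 3 * η) * X ^ c ≤ Y := by linarith
  have hYu : Y ≤ (1 + 2 * η) * X ^ c := by rw [hXc] at hpc ⊢; linarith
  have hY0 : 0 < Y := lt_of_lt_of_le (mul_pos (by linarith) (by positivity)) hYl
  set y : ℝ := Y ^ γ with hy
  have hy0 : 0 < y := by positivity
  have hyc : y ^ c = Y := by rw [hy, ← Real.rpow_mul hY0.le, mul_comm, hcγ, Real.rpow_one]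
  have hyl : (1 - 3 * η) * X ≤ y := by
    have := mul_rpow_le_rpow hγ0 hγ1 (by linarith) (by linarith) (by positivity) hYl
    rwa [hXγ] at this
  have hyu : y ≤ (1 + 2 * η) * X := by
    calc y ≤ ((1 + 2 * η) * X ^ c) ^ γ := by rw [hy]; gcongr
      _ = (1 + 2 * η) ^ γ * X := by rw [Real.mul_rpow (by linarith) (by positivity), hXγ]
      _ ≤ (1 + 2 * η) * X := by
        gcongr
        exact Real.rpow_le_self_of_one_le (by linarith) hγ1
  refine ⟨⌊y⌋₊ + 1, Nat.succ_pos _, ?_⟩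
  have hm : ((⌊y⌋₊ + 1 : ℕ) : ℝ) = y + (1 - Int.fract y) := by
    have : ((⌊y⌋₊ : ℕ) : ℝ) = (⌊y⌋ : ℝ) := natCast_floor_eq_intCast_floor hy0.le
    push_cast
    linarith [Int.floor_add_fract y]
  rw [hm]
  set t : ℝ := 1 - Int.fract y with ht
  have htl : (1 - η) * δ < t := by linarith
  have htu : t < (1 + η) * δ := by linarith
  have htX : t ≤ η * X := by nlinarith
  obtain ⟨hl, hu⟩ := near_one_rpow_add_sub_rpow hc1 hc2 hη0 hη1 hX0 hy0 hδ0 hδX hyl hyu htl htu htX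
  rw [hyc] at hl hu
  exact floor_add_floor_eq_of_near_one hl hu hf hf'
end

section
/- Let 1 < c < 3/2 and γ = 1/c. There is a constant C = C(c) such that for all sufficiently large real N the following holds. Set η = (log N)^{-2}, X = (N/2)^γ and X₁ = (1 + η)X. Then the number S of integers m with X < m ≤ X₁ and ‖m^c‖ < 6η satisfies S ≤ C · η² X. -/
/-- A finite set of integers of diameter at most `D` has at most `D + 1` elements. -/
lemma card_le_of_sub_le (T : Finset ℤ) (D : ℝ) (hD : 0 ≤ D)
    (h : ∀ m ∈ T, ∀ m' ∈ T, (m : ℝ) - m' ≤ D) : (T.card : ℝ) ≤ D + 1 := by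
  rcases T.eq_empty_or_nonempty with rfl | hT
  · simp only [Finset.card_empty, Nat.cast_zero]; linarith
  · have hsub : T ⊆ Finset.Icc (T.min' hT) (T.min' hT + ⌊D⌋) := by
      intro m hm
      have h1 : m - T.min' hT ≤ ⌊D⌋ := by
        rw [Int.le_floor]
        push_cast
        exact h m hm _ (T.min'_mem hT)
      exact Finset.mem_Icc.2 ⟨T.min'_le m hm, by linarith⟩
    have hcard := Finset.card_le_card hsub
    rw [Int.card_Icc] at hcard
    have hfloor : 0 ≤ ⌊D⌋ := Int.floor_nonneg.2 hD
    have h2 : (T.card : ℤ) ≤ ⌊D⌋ + 1 := by omega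
    have h3 : (T.card : ℝ) ≤ ⌊D⌋ + 1 := by exact_mod_cast h2
    linarith [Int.floor_le D]

/-- Let `d * α` be at distance between `14 * η` and `28 * η` from an integer. Two points where a
nearly linear function of slope `α` is close to an integer do not differ by a small positive
multiple of `d`. -/
lemma ne_add_mul_of_near_integer {f : ℤ → ℝ} {α η : ℝ} {d a : ℤ} {K t : ℕ} {m m' : ℤ}
    (hη : 0 < η) (hK : 56 * η * K ≤ 1)
    (hlow : 14 * η ≤ |d * α - a|) (hupp : |d * α - a| ≤ 28 * η)
    (hlin : |f m - f m' - ((m : ℝ) - m') * α| ≤ η)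
    (hm : |f m - round (f m)| < 6 * η) (hm' : |f m' - round (f m')| < 6 * η)
    (ht : 1 ≤ t) (htK : t + 1 ≤ K) : m ≠ m' + t * d := by
  rintro rfl
  set r := round (f (m' + t * d))
  set r' := round (f m')
  have ht1 : (1 : ℝ) ≤ t := by exact_mod_cast ht
  have htK1 : (t : ℝ) + 1 ≤ K := by exact_mod_cast htK
  have habs : |(t : ℝ) * (d * α - a)| = t * |d * α - a| := by
    rw [abs_mul, abs_of_pos (by linarith : (0 : ℝ) < t)]
  have hge : 14 * η ≤ |(t : ℝ) * (d * α - a)| := by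
    rw [habs]; nlinarith
  have hle : |(t : ℝ) * (d * α - a)| ≤ 1 / 2 - 28 * η := by
    rw [habs]; nlinarith
  have hclose : |(t : ℝ) * (d * α - a) - ((r - r' - t * a : ℤ) : ℝ)| < 13 * η := by
    push_cast at hlin ⊢
    rw [abs_le] at hlin
    rw [abs_lt] at hm hm' ⊢
    constructor <;> nlinarith
  rcases eq_or_ne (r - r' - t * a) 0 with h0 | h0
  · rw [h0, Int.cast_zero, sub_zero] at hclose
    linarith
  · have h1 : (1 : ℝ) ≤ |((r - r' - t * a : ℤ) : ℝ)| := by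
      exact_mod_cast Int.one_le_abs h0
    have h2 := abs_sub_abs_le_abs_sub ((r - r' - t * a : ℤ) : ℝ) ((t : ℝ) * (d * α - a))
    rw [abs_sub_comm] at h2
    linarith

/-- Points of a block where a nearly linear function is close to an integer are few, because
suitably many translates of the set of these points are disjoint. -/
lemma card_mul_le_of_nearly_linear {f : ℤ → ℝ} {α η : ℝ} {d a b M : ℤ} {K : ℕ} {P : Finset ℤ}
    (hη : 0 < η) (hK : 56 * η * K ≤ 1) (hd : 0 < d) (hM : 0 ≤ M)
    (hlow : 14 * η ≤ |d * α - a|) (hupp : |d * α - a| ≤ 28 * η)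
    (hP : P ⊆ Finset.Ico b (b + M))
    (hlin : ∀ m ∈ P, ∀ m' ∈ P, |f m - f m' - ((m : ℝ) - m') * α| ≤ η)
    (hnear : ∀ m ∈ P, |f m - round (f m)| < 6 * η) :
    (P.card : ℤ) * K ≤ M + K * d := by
  have hne : ∀ m ∈ P, ∀ m' ∈ P, ∀ j j' : ℕ, j < j' → j' < K →
      m + j * d ≠ m' + j' * d := by
    intro m hm m' hm' j j' hjj hj' h
    refine ne_add_mul_of_near_integer (t := j' - j) hη hK hlow hupp (hlin m hm m' hm')
      (hnear m hm) (hnear m' hm') (by omega) (by omega) ?_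
    push_cast [Nat.cast_sub hjj.le]
    linarith
  have hcard : (P ×ˢ Finset.range K).card ≤ (Finset.Ico b (b + M + K * d)).card := by
    refine Finset.card_le_card_of_injOn (fun p => p.1 + p.2 * d) ?_ ?_
    · rintro ⟨m, j⟩ hp
      obtain ⟨hm, hj⟩ := Finset.mem_product.1 hp
      have hm2 := Finset.mem_Ico.1 (hP hm)
      have hj2 : (j : ℤ) ≤ K := by exact_mod_cast (Finset.mem_range.1 hj).le
      have h1 : (j : ℤ) * d ≤ K * d := mul_le_mul_of_nonneg_right hj2 hd.le
      have h2 : 0 ≤ (j : ℤ) * d := by positivity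
      simp only [Finset.coe_Ico, Set.mem_Ico] at hm2 ⊢
      constructor <;> linarith
    · rintro ⟨m, j⟩ hp ⟨m', j'⟩ hp' h
      obtain ⟨hm, hj⟩ := Finset.mem_product.1 (Finset.mem_coe.1 hp)
      obtain ⟨hm', hj'⟩ := Finset.mem_product.1 (Finset.mem_coe.1 hp')
      simp only [Finset.mem_range] at hm hj hm' hj' h
      rcases lt_trichotomy j j' with hlt | rfl | hlt
      · exact absurd h (hne m hm m' hm' j j' hlt hj')
      · simpa using h
      · exact absurd h.symm (hne m' hm' m hm j' j hlt hj)
  rw [Finset.card_product, Finset.card_range, Int.card_Ico] at hcard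
  have hpos : 0 ≤ M + K * d := by positivity
  have : ((P.card * K : ℕ) : ℤ) ≤ M + K * d := by omega
  exact_mod_cast this

/-- If no small multiple of `α` is within `ε` of an integer, then some moderate multiple
of `α` has distance between `s` and `2 * s` from an integer. -/
lemma exists_mul_sub_mem_Icc {α s ε : ℝ} {Q : ℕ} (hε : 0 < ε) (hs : 0 < s)
    (hQ : 1 / s ≤ Q)
    (h : ∀ q : ℕ, 1 ≤ q → q ≤ Q → ∀ a : ℤ, ε < |q * α - a|) :
    ∃ d a : ℤ, 0 < d ∧ (d : ℝ) ≤ Q * (s / ε + 1) ∧ s ≤ |d * α - a| ∧ |d * α - a| ≤ 2 * s := by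
  have hQ0 : (0 : ℝ) < Q := lt_of_lt_of_le (by positivity) hQ
  obtain ⟨j, k, hk0, hkQ, hjk⟩ := Real.exists_int_int_abs_mul_sub_le α (Nat.cast_pos.1 hQ0)
  lift k to ℕ using hk0.le
  have hδε := h k (by omega) (by omega) j
  push_cast at hjk
  set δ := |(k : ℝ) * α - j|
  have hδ : 0 < δ := hε.trans hδε
  have hδs : δ ≤ s := by
    refine hjk.trans ?_
    rw [div_le_iff₀ (by positivity)]
    rw [div_le_iff₀ hs] at hQ
    nlinarith
  have ht := Nat.le_ceil (s / δ)
  have ht' := Nat.ceil_lt_add_one (show 0 ≤ s / δ by positivity)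
  have ht0 : 0 < ⌈s / δ⌉₊ := Nat.ceil_pos.2 (by positivity)
  set t := ⌈s / δ⌉₊
  have habs : |((t * k : ℤ) : ℝ) * α - ((t * j : ℤ) : ℝ)| = t * δ := by
    push_cast
    rw [show (t : ℝ) * k * α - t * j = t * (k * α - j) by ring, abs_mul, Nat.abs_cast]
  refine ⟨t * k, t * j, by positivity, ?_, ?_, ?_⟩
  · push_cast
    rw [mul_comm]
    have h1 : (k : ℝ) ≤ Q := by exact_mod_cast hkQ
    have h2 : s / δ ≤ s / ε := by gcongr
    gcongr
    linarith
  · rw [habs]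
    rwa [div_le_iff₀ hδ] at ht
  · rw [habs]
    have : (t : ℝ) * δ ≤ (s / δ + 1) * δ := by gcongr
    rw [add_mul, div_mul_cancel₀ _ hδ.ne'] at this
    linarith

/-- A function on integers whose increments are at least `μ` times those of the identity has few
values with a small multiple within `ε` of an integer. -/
lemma card_near_rational_le {g : ℤ → ℝ} {T : Finset ℤ} {ε μ G : ℝ} {Q : ℕ}
    (hε : 0 < ε) (hε1 : ε ≤ 1) (hμ : 0 < μ) (hG : ∀ m ∈ T, 0 ≤ g m ∧ g m ≤ G) (hG0 : 0 ≤ G)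
    (hg : ∀ m ∈ T, ∀ m' ∈ T, m ≤ m' → μ * ((m' : ℝ) - m) ≤ g m' - g m)
    (hT : ∀ m ∈ T, ∃ q : ℕ, 1 ≤ q ∧ q ≤ Q ∧ ∃ a : ℤ, |q * g m - a| ≤ ε) :
    (T.card : ℝ) ≤ Q * (Q * G + 3) * (2 * ε / μ + 1) := by
  choose! q hq1 hqQ a ha using hT
  have hmaps : ∀ m ∈ T, (q m, a m) ∈ Finset.Icc 1 Q ×ˢ Finset.Icc (-1 : ℤ) ⌊Q * G + 1⌋ := by
    intro m hm
    have h1 := abs_le.1 (ha m hm)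
    obtain ⟨h0, hGm⟩ := hG m hm
    have hq : (q m : ℝ) ≤ Q := by exact_mod_cast hqQ m hm
    have h2 : (q m : ℝ) * g m ≤ Q * G := by gcongr
    have h3 : 0 ≤ (q m : ℝ) * g m := by positivity
    simp only [Finset.mem_product, Finset.mem_Icc, Int.le_floor]
    refine ⟨⟨hq1 m hm, hqQ m hm⟩, ?_, by linarith⟩
    have : (-1 : ℝ) ≤ a m := by linarith
    exact_mod_cast this
  have hcard := Finset.card_le_mul_card_image_of_maps_to hmaps ⌊2 * ε / μ + 1⌋₊ ?_
  · have hcard' : (T.card : ℝ) ≤ ⌊2 * ε / μ + 1⌋₊ *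
        ((Finset.Icc 1 Q ×ˢ Finset.Icc (-1 : ℤ) ⌊Q * G + 1⌋).card : ℝ) := by exact_mod_cast hcard
    refine hcard'.trans ?_
    rw [mul_comm, Finset.card_product, Nat.card_Icc, Int.card_Icc]
    have h1 : ((⌊Q * G + 1⌋ + 1 - -1).toNat : ℝ) ≤ Q * G + 3 := by
      have hfl : 0 ≤ ⌊Q * G + 1⌋ := Int.floor_nonneg.2 (by positivity)
      have h2 : (((⌊Q * G + 1⌋ + 1 - -1).toNat : ℤ) : ℝ) = ((⌊Q * G + 1⌋ + 1 - -1 : ℤ) : ℝ) := by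
        rw [Int.toNat_of_nonneg (by omega)]
      rw [Int.cast_natCast] at h2
      rw [h2]
      push_cast
      linarith [Int.floor_le (Q * G + 1)]
    have h3 : ((⌊2 * ε / μ + 1⌋₊ : ℕ) : ℝ) ≤ 2 * ε / μ + 1 := Nat.floor_le (by positivity)
    push_cast
    gcongr
  · rintro ⟨q₀, a₀⟩ -
    rw [Nat.le_floor_iff (by positivity)]
    refine card_le_of_sub_le _ _ (by positivity) ?_
    intro m hm m' hm'
    simp only [Finset.mem_filter, Prod.mk.injEq] at hm hm'
    obtain ⟨hm, hqm, ham⟩ := hm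
    obtain ⟨hm', hqm', ham'⟩ := hm'
    rcases le_total m m' with hle | hle
    · have : (m : ℝ) ≤ m' := by exact_mod_cast hle
      have : 0 ≤ 2 * ε / μ := by positivity
      linarith
    · rw [le_div_iff₀ hμ]
      have h1 := abs_le.1 (ha m hm)
      have h2 := abs_le.1 (ha m' hm')
      have h3 := hg m' hm' m hm hle
      have h4 : (1 : ℝ) ≤ q m := by exact_mod_cast hq1 m hm
      rw [hqm', ← hqm, ham', ← ham] at h2
      have h5 : (m' : ℝ) ≤ m := by exact_mod_cast hle
      have h6 : 0 ≤ μ * ((m : ℝ) - m') := mul_nonneg hμ.le (by linarith)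
      have h7 : g m - g m' ≤ q m * (g m - g m') :=
        le_mul_of_one_le_left (h6.trans h3) h4
      nlinarith

/-- Two-sided bounds for the increments of the derivative of `x ^ c` on `[X, 2 * X]`. -/
lemma deriv_rpow_sub_bounds {c X x x' : ℝ} (hc1 : 1 < c) (hc2 : c < 3 / 2) (hX : 0 < X)
    (hx : X ≤ x) (hxx : x ≤ x') (hx' : x' ≤ 2 * X) :
    (c - 1) / 2 * X ^ (c - 2) * (x' - x) ≤ c * x' ^ (c - 1) - c * x ^ (c - 1) ∧
      c * x' ^ (c - 1) - c * x ^ (c - 1) ≤ X ^ (c - 2) * (x' - x) := by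
  rcases hxx.eq_or_lt with rfl | hlt
  · simp
  have hderiv : ∀ z ∈ Set.Icc x x',
      HasDerivAt (fun z : ℝ => c * z ^ (c - 1)) (c * ((c - 1) * z ^ (c - 2))) z := by
    intro z hz
    have h := (Real.hasDerivAt_rpow_const (x := z) (p := c - 1)
      (Or.inl (hX.trans_le (hx.trans hz.1)).ne')).const_mul c
    rwa [show c - 1 - 1 = c - 2 by ring] at h
  obtain ⟨ξ, hξ, heq⟩ := exists_hasDerivAt_eq_slope (fun z : ℝ => c * z ^ (c - 1)) _ hlt
    (fun z hz => (hderiv z hz).continuousAt.continuousWithinAt)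
    (fun z hz => hderiv z (Set.Ioo_subset_Icc_self hz))
  rw [eq_div_iff (sub_pos.2 hlt).ne'] at heq
  rw [← heq]
  have hξ0 : 0 < ξ := by linarith [hξ.1]
  have hup : ξ ^ (c - 2) ≤ X ^ (c - 2) :=
    Real.rpow_le_rpow_of_nonpos hX (by linarith [hξ.1]) (by linarith)
  have hlow : X ^ (c - 2) / 2 ≤ ξ ^ (c - 2) := by
    have h1 : (2 * X) ^ (c - 2) ≤ ξ ^ (c - 2) :=
      Real.rpow_le_rpow_of_nonpos hξ0 (by linarith [hξ.2]) (by linarith)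
    have h2 : (2 : ℝ) ^ (-1 : ℝ) ≤ 2 ^ (c - 2) :=
      Real.rpow_le_rpow_of_exponent_le (by norm_num) (by linarith)
    rw [Real.rpow_neg_one] at h2
    rw [Real.mul_rpow (by norm_num) hX.le] at h1
    have h3 : 0 < X ^ (c - 2) := by positivity
    nlinarith
  have hpos : 0 < x' - x := sub_pos.2 hlt
  have hX2 : 0 < X ^ (c - 2) := by positivity
  have hξ2 : 0 < ξ ^ (c - 2) := by positivity
  constructor
  · refine mul_le_mul_of_nonneg_right ?_ hpos.le
    nlinarith [mul_pos (sub_pos.2 hc1) hξ2, mul_le_mul_of_nonneg_left hlow (sub_pos.2 hc1).le,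
      mul_pos (mul_pos (sub_pos.2 hc1) (sub_pos.2 hc1)) hξ2]
  · gcongr
    have h1 : c * (c - 1) ≤ 1 := by nlinarith
    nlinarith

/-- The power `x ^ c` is nearly linear on short subintervals of `[X, 2 * X]`. -/
lemma abs_rpow_sub_linear_le {c X x x' x₀ D : ℝ} (hc1 : 1 < c) (hc2 : c < 3 / 2) (hX : 0 < X)
    (hx : x ∈ Set.Icc X (2 * X)) (hx' : x' ∈ Set.Icc X (2 * X)) (hx₀ : x₀ ∈ Set.Icc X (2 * X))
    (h₁ : |x - x'| ≤ D) (h₂ : |x - x₀| ≤ D) (h₃ : |x' - x₀| ≤ D) :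
    |x ^ c - x' ^ c - (x - x') * (c * x₀ ^ (c - 1))| ≤ X ^ (c - 2) * D ^ 2 := by
  wlog hlt : x' ≤ x generalizing x x'
  · have := this hx' hx (by rwa [abs_sub_comm]) h₃ h₂ (le_of_not_ge hlt)
    rwa [← abs_neg, show -(x ^ c - x' ^ c - (x - x') * (c * x₀ ^ (c - 1))) =
      x' ^ c - x ^ c - (x' - x) * (c * x₀ ^ (c - 1)) by ring]
  have hX2 : 0 < X ^ (c - 2) := by positivity
  rcases hlt.eq_or_lt with rfl | hlt
  · simp only [sub_self, zero_mul, abs_zero]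
    positivity
  have hderiv : ∀ z ∈ Set.Icc x' x, HasDerivAt (fun z : ℝ => z ^ c) (c * z ^ (c - 1)) z :=
    fun z hz => Real.hasDerivAt_rpow_const (Or.inr hc1.le)
  obtain ⟨ξ, hξ, heq⟩ := exists_hasDerivAt_eq_slope (fun z : ℝ => z ^ c) _ hlt
    (fun z hz => (hderiv z hz).continuousAt.continuousWithinAt)
    (fun z hz => hderiv z (Set.Ioo_subset_Icc_self hz))
  rw [eq_div_iff (sub_pos.2 hlt).ne'] at heq
  rw [← heq, mul_comm (c * ξ ^ (c - 1)), ← mul_sub, abs_mul]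
  have hξX : ξ ∈ Set.Icc X (2 * X) := ⟨hx'.1.trans hξ.1.le, hξ.2.le.trans hx.2⟩
  have hξ₀ : |ξ - x₀| ≤ D := by
    rw [abs_le] at *
    constructor <;> linarith [hξ.1, hξ.2]
  have hslope : |c * ξ ^ (c - 1) - c * x₀ ^ (c - 1)| ≤ X ^ (c - 2) * |ξ - x₀| := by
    have hkey : ∀ u v : ℝ, X ≤ u → u ≤ v → v ≤ 2 * X →
        |c * v ^ (c - 1) - c * u ^ (c - 1)| ≤ X ^ (c - 2) * |v - u| := by
      intro u v hu huv hv
      obtain ⟨hl, hr⟩ := deriv_rpow_sub_bounds hc1 hc2 hX hu huv hv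
      have h0 : 0 ≤ (c - 1) / 2 * X ^ (c - 2) * (v - u) :=
        mul_nonneg (mul_nonneg (by linarith) hX2.le) (by linarith)
      rwa [abs_of_nonneg (h0.trans hl), abs_of_nonneg (by linarith : 0 ≤ v - u)]
    rcases le_total ξ x₀ with h | h
    · rw [abs_sub_comm, abs_sub_comm ξ]
      exact hkey _ _ hξX.1 h hx₀.2
    · exact hkey _ _ hx₀.1 h hξX.2
  have hD : 0 ≤ D := (abs_nonneg _).trans h₁
  calc |x - x'| * |c * ξ ^ (c - 1) - c * x₀ ^ (c - 1)|
      ≤ D * (X ^ (c - 2) * D) := by gcongr; exact hslope.trans (by gcongr)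
    _ = X ^ (c - 2) * D ^ 2 := by ring

set_option maxHeartbeats 1000000 in
open scoped Classical in
/-- The counting bound in terms of a parameter `y` with `X = y ^ 64` and `1 / y ≤ η`. -/
lemma card_near_integer_powers_le {c X η y : ℝ} (hc1 : 1 < c) (hc2 : c < 3 / 2)
    (hy : 100 ≤ y) (hyc : 48 / (c - 1) ≤ y) (hXy : X = y ^ 64) (hηy : 1 / y ≤ η)
    (hη : η ≤ 1 / 112) (A : Finset ℤ) (hA : ∀ m ∈ A, X < m ∧ (m : ℝ) ≤ (1 + η) * X)
    (hnear : ∀ m ∈ A, |(m : ℝ) ^ c - round ((m : ℝ) ^ c)| < 6 * η) :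
    (A.card : ℝ) ≤ 226 * η ^ 2 * X := by
  have hy0 : 0 < y := by linarith
  have hX : 0 < X := by rw [hXy]; positivity
  have hη0 : 0 < η := lt_of_lt_of_le (by positivity) hηy
  have hinv : 1 / η ≤ y := by
    rw [div_le_iff₀ hη0]
    rwa [div_le_iff₀ hy0, mul_comm] at hηy
  have hAX : ∀ m ∈ A, (m : ℝ) ∈ Set.Icc X (2 * X) := fun m hm =>
    ⟨(hA m hm).1.le, (hA m hm).2.trans (by nlinarith)⟩
  set U := X ^ (c - 1) with hU
  have hU1 : 1 ≤ U := Real.one_le_rpow (by rw [hXy]; exact one_le_pow₀ (by linarith)) (by linarith)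
  have hUX : X ^ (c - 2) = U / X := by
    rw [hU, show c - 2 = c - 1 - 1 by ring, Real.rpow_sub_one hX.ne']
  have hUy : U ≤ y ^ 32 := by
    have h1 : U ≤ X ^ (1 / 2 : ℝ) := Real.rpow_le_rpow_of_exponent_le
      (by rw [hXy]; exact one_le_pow₀ (by linarith)) (by linarith)
    rwa [← Real.sqrt_eq_rpow, hXy, show y ^ 64 = (y ^ 32) ^ 2 by ring,
      Real.sqrt_sq (by positivity)] at h1
  set g : ℤ → ℝ := fun m => c * (m : ℝ) ^ (c - 1)
  set ε := 1 / y ^ 6 with hεdef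
  have hε : 0 < ε := by positivity
  set Q := ⌈1 / (14 * η)⌉₊
  have hQ : 1 / (14 * η) ≤ Q := Nat.le_ceil _
  have hQy : (Q : ℝ) ≤ y := by
    have h1 := Nat.ceil_lt_add_one (show 0 ≤ 1 / (14 * η) by positivity)
    have h2 : 1 / (14 * η) = 1 / η / 14 := by field_simp
    linarith
  set K := ⌊1 / (56 * η)⌋₊
  have h56 : 1 / (56 * η) = 1 / η / 56 := by field_simp
  have hKle : (K : ℝ) ≤ 1 / (56 * η) := Nat.floor_le (by positivity)
  have hKη : 56 * η * K ≤ 1 := by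
    rwa [le_div_iff₀ (by positivity), mul_comm] at hKle
  have hKge : 1 / (112 * η) ≤ K := by
    have h1 := Nat.lt_floor_add_one (1 / (56 * η))
    have h2 : 112 ≤ 1 / η := by rw [le_div_iff₀ hη0]; linarith
    have h3 : 1 / (112 * η) = 1 / η / 112 := by field_simp
    rw [h3]
    linarith
  have hK0 : (0 : ℝ) < K := lt_of_lt_of_le (by positivity) hKge
  have hKinv : 1 / (K : ℝ) ≤ 112 * η := by
    rw [div_le_iff₀ hK0]
    rwa [div_le_iff₀ (by positivity), mul_comm] at hKge
  set M := ⌈y ^ 8⌉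
  have hMy : y ^ 8 ≤ M := Int.le_ceil _
  have hy8 : 1 ≤ y ^ 8 := one_le_pow₀ (by linarith)
  have hMy' : (M : ℝ) ≤ 2 * y ^ 8 := by
    linarith [Int.ceil_lt_add_one (y ^ 8)]
  have hM0 : (0 : ℝ) < M := by linarith
  have hM0' : 0 < M := by exact_mod_cast hM0
  set bad : ℤ → Prop := fun m => ∃ q : ℕ, 1 ≤ q ∧ q ≤ Q ∧ ∃ a : ℤ, |q * g m - a| ≤ ε
  have hcardBad : ((A.filter bad).card : ℝ) ≤ η ^ 2 * X := by
    have hcard := card_near_rational_le (g := g) (T := A.filter bad) (ε := ε)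
      (μ := (c - 1) / 2 * X ^ (c - 2)) (G := 3 * U) (Q := Q) hε
      (by rw [hεdef, div_le_one (by positivity)]; exact one_le_pow₀ (by linarith))
      (by have := sub_pos.2 hc1; positivity) ?_ (by positivity) ?_ ?_
    · refine hcard.trans ?_
      have hc0 : 0 < c - 1 := by linarith
      have h1 : 2 * ε / ((c - 1) / 2 * X ^ (c - 2)) = 4 / (c - 1) * X / (y ^ 6 * U) := by
        rw [hUX, hεdef]; field_simp; norm_num
      rw [h1]
      calc (Q : ℝ) * (Q * (3 * U) + 3) * (4 / (c - 1) * X / (y ^ 6 * U) + 1)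
          ≤ y * (y * (3 * U) + 3 * (y * U)) * (4 / (c - 1) * X / (y ^ 6 * U) + 1) := by
            gcongr
            nlinarith
        _ = 48 / (c - 1) / 2 * X / y ^ 4 + 6 * y ^ 2 * U := by field_simp; ring
        _ ≤ y / 2 * X / y ^ 4 + 6 * y ^ 2 * y ^ 32 := by gcongr
        _ = y ^ 61 / 2 + 6 * y ^ 34 := by rw [hXy]; field_simp
        _ ≤ y ^ 62 := by
            have h2 : y ^ 34 ≤ y ^ 61 := pow_le_pow_right₀ (by linarith) (by norm_num)
            have h3 : y ^ 62 = y * y ^ 61 := by ring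
            have h4 : 0 < y ^ 61 := by positivity
            nlinarith
        _ = (1 / y) ^ 2 * X := by rw [hXy]; field_simp
        _ ≤ η ^ 2 * X := by gcongr
    · intro m hm
      have hmX := hAX m (Finset.mem_filter.1 hm).1
      have hm0 : (0 : ℝ) < m := hX.trans_le hmX.1
      refine ⟨by positivity, ?_⟩
      have h1 : (m : ℝ) ^ (c - 1) ≤ (2 * X) ^ (c - 1) :=
        Real.rpow_le_rpow hm0.le hmX.2 (by linarith)
      rw [Real.mul_rpow (by norm_num) hX.le] at h1
      have h2 : (2 : ℝ) ^ (c - 1) ≤ 2 ^ (1 : ℝ) :=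
        Real.rpow_le_rpow_of_exponent_le (by norm_num) (by linarith)
      rw [Real.rpow_one] at h2
      have h3 : (m : ℝ) ^ (c - 1) ≤ 2 * U := h1.trans (by gcongr)
      calc c * (m : ℝ) ^ (c - 1) ≤ 3 / 2 * (2 * U) := by gcongr
        _ = 3 * U := by ring
    · intro m hm m' hm' hmm
      exact (deriv_rpow_sub_bounds hc1 hc2 hX (hAX m (Finset.mem_filter.1 hm).1).1
        (by exact_mod_cast hmm) (hAX m' (Finset.mem_filter.1 hm').1).2).1
    · exact fun m hm => (Finset.mem_filter.1 hm).2
  have hblock : ∀ k : ℤ, (((A.filter (fun m => ¬ bad m)).filter (fun m => m / M = k)).card : ℝ)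
      ≤ 224 * η * M := by
    intro k
    set P := (A.filter (fun m => ¬ bad m)).filter (fun m => m / M = k) with hP
    have hPmem : ∀ m ∈ P, m ∈ A ∧ ¬ bad m ∧ m / M = k := fun m hm => by
      simpa [hP, and_assoc] using hm
    rcases P.eq_empty_or_nonempty with hemp | ⟨m₀, hm₀⟩
    · rw [hemp, Finset.card_empty, Nat.cast_zero]
      positivity
    obtain ⟨d, a, hd0, hd, hlow, hupp⟩ := exists_mul_sub_mem_Icc (α := g m₀) (s := 14 * η)
      (ε := ε) (Q := Q) hε (by positivity) hQ (by
        intro q hq1 hqQ a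
        by_contra! hcon
        exact (hPmem m₀ hm₀).2.1 ⟨q, hq1, hqQ, a, hcon⟩)
    have hIco : ∀ m ∈ P, k * M ≤ m ∧ m < k * M + M := by
      intro m hm
      have h1 := Int.mul_ediv_add_emod m M
      have h2 := Int.emod_nonneg m hM0'.ne'
      have h3 := Int.emod_lt_of_pos m hM0'
      rw [(hPmem m hm).2.2, mul_comm] at h1
      constructor <;> linarith
    have hdist : ∀ m ∈ P, ∀ m' ∈ P, |(m : ℝ) - m'| ≤ M := by
      intro m hm m' hm'
      have h1 := hIco m hm
      have h2 := hIco m' hm'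
      have h3 : |m - m'| ≤ M := abs_le.2 ⟨by linarith, by linarith⟩
      exact_mod_cast h3
    have hcard := card_mul_le_of_nearly_linear (f := fun m : ℤ => (m : ℝ) ^ c) (α := g m₀)
      (b := k * M) (M := M) (K := K) (P := P) hη0 hKη hd0 hM0'.le hlow (by linarith)
      (fun m hm => Finset.mem_Ico.2 (hIco m hm)) (by
        intro m hm m' hm'
        refine (abs_rpow_sub_linear_le hc1 hc2 hX (hAX m (hPmem m hm).1) (hAX m' (hPmem m' hm').1)
          (hAX m₀ (hPmem m₀ hm₀).1) (hdist m hm m' hm') (hdist m hm m₀ hm₀)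
          (hdist m' hm' m₀ hm₀)).trans ?_
        rw [hUX]
        calc U / X * (M : ℝ) ^ 2 ≤ y ^ 32 / X * (2 * y ^ 8) ^ 2 := by gcongr
          _ = 4 / y ^ 15 * (1 / y) := by rw [hXy]; field_simp; norm_num
          _ ≤ 1 * η := by
              gcongr
              rw [div_le_one (by positivity)]
              calc (4 : ℝ) ≤ y := by linarith
                _ ≤ y ^ 15 := le_self_pow₀ (by linarith) (by norm_num)
          _ = η := one_mul η)
      (fun m hm => hnear m (hPmem m hm).1)
    have hcard' : (P.card : ℝ) * K ≤ M + K * d := by exact_mod_cast hcard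
    have hdy : (d : ℝ) ≤ y ^ 7 := by
      have h6 : 100 ≤ y ^ 6 := hy.trans (le_self_pow₀ (by linarith) (by norm_num))
      have h1 : 14 * η / ε + 1 ≤ y ^ 6 := by
        rw [hεdef, div_div_eq_mul_div, div_one]
        nlinarith
      calc (d : ℝ) ≤ Q * (14 * η / ε + 1) := hd
        _ ≤ y * y ^ 6 := by gcongr
        _ = y ^ 7 := by ring
    have hKd : (K : ℝ) * d ≤ M := by
      have hKy : (K : ℝ) ≤ y := by rw [h56] at hKle; linarith
      calc (K : ℝ) * d ≤ y * y ^ 7 := by gcongr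
        _ = y ^ 8 := by ring
        _ ≤ M := hMy
    have h2 : (P.card : ℝ) ≤ 2 * M * (1 / K) := by
      rw [mul_one_div, le_div_iff₀ hK0]
      linarith
    calc (P.card : ℝ) ≤ 2 * M * (1 / K) := h2
      _ ≤ 2 * M * (112 * η) := by gcongr
      _ = 224 * η * M := by ring
  have hgood : ((A.filter (fun m => ¬ bad m)).card : ℝ) ≤ 225 * η ^ 2 * X := by
    have hcard := Finset.card_le_mul_card_image (f := fun m : ℤ => m / M)
      (A.filter (fun m => ¬ bad m)) ⌊224 * η * M⌋₊
      (fun k _ => (Nat.le_floor_iff (by positivity)).2 (hblock k))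
    have himage : (((A.filter (fun m => ¬ bad m)).image (fun m : ℤ => m / M)).card : ℝ) ≤
        η * X / M + 1 + 1 := by
      refine card_le_of_sub_le _ _ (by positivity) ?_
      intro k hk k' hk'
      obtain ⟨m, hm, rfl⟩ := Finset.mem_image.1 hk
      obtain ⟨m', hm', rfl⟩ := Finset.mem_image.1 hk'
      have h1 := hA m (Finset.mem_filter.1 hm).1
      have h2 := hA m' (Finset.mem_filter.1 hm').1
      have h3 : ((m / M : ℤ) : ℝ) * M ≤ m := by
        exact_mod_cast Int.ediv_mul_le m hM0'.ne'
      have h4 : (m' : ℝ) < ((m' / M : ℤ) + 1 : ℝ) * M := by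
        exact_mod_cast Int.lt_ediv_add_one_mul_self m' hM0'
      rw [div_add_one hM0.ne', le_div_iff₀ hM0]
      linarith
    have hcard' : ((A.filter (fun m => ¬ bad m)).card : ℝ) ≤ ⌊224 * η * M⌋₊ *
        (((A.filter (fun m => ¬ bad m)).image (fun m : ℤ => m / M)).card : ℝ) := by
      exact_mod_cast hcard
    have hfl : (⌊224 * η * M⌋₊ : ℝ) ≤ 224 * η * M := Nat.floor_le (by positivity)
    calc ((A.filter (fun m => ¬ bad m)).card : ℝ)
        ≤ 224 * η * M * (η * X / M + 1 + 1) := hcard'.trans (by gcongr)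
      _ = 224 * η ^ 2 * X + η * (448 * M) := by field_simp; ring
      _ ≤ 224 * η ^ 2 * X + η * (1 / y * X) := by
          refine add_le_add_right (mul_le_mul_of_nonneg_left ?_ hη0.le) _
          calc 448 * (M : ℝ) ≤ 448 * (2 * y ^ 8) := by gcongr
            _ = 896 * y ^ 8 := by ring
            _ ≤ y ^ 2 * y ^ 8 := by gcongr; nlinarith
            _ = y ^ 10 := by ring
            _ ≤ y ^ 63 := pow_le_pow_right₀ (by linarith) (by norm_num)
            _ = 1 / y * X := by rw [hXy]; field_simp
      _ ≤ 224 * η ^ 2 * X + η * (η * X) := by gcongr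
      _ = 225 * η ^ 2 * X := by ring
  have hsplit : ((A.filter bad).card : ℝ) + ((A.filter (fun m => ¬ bad m)).card : ℝ) = A.card := by
    exact_mod_cast Finset.card_filter_add_card_filter_not bad
  linarith

open scoped Classical in
/-- For `1 < c < 3/2`, `γ = 1/c`, and sufficiently large real `N`: with
`η = (log N)⁻²`, `X = (N/2)^γ`, `X₁ = (1+η)X`, the number of integers
`X < m ≤ X₁` with `‖m^c‖ < 6η` is at most `C η² X`. -/
theorem count_near_integer_powers_short_interval (c γ : ℝ) (hc1 : 1 < c)
    (hc2 : c < 3 / 2) (hγ : γ = 1 / c) :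
    ∃ C : ℝ, ∀ᶠ N : ℝ in Filter.atTop, ∀ η X X₁ : ℝ,
      η = ((Real.log N) ^ 2)⁻¹ → X = (N / 2) ^ γ → X₁ = (1 + η) * X →
      ((((Finset.Ioc ⌊X⌋ ⌊X₁⌋).filter
          (fun m : ℤ => |(m : ℝ) ^ c - round ((m : ℝ) ^ c)| < 6 * η)).card : ℝ) ≤
        C * η ^ 2 * X) := by
  have hc0 : 0 < c := by linarith
  have hγ0 : 0 < γ := by rw [hγ]; positivity
  refine ⟨226, ?_⟩
  have hρ : 0 < γ / 64 := by positivity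
  have htop : Filter.Tendsto (fun N : ℝ => (N / 2) ^ (γ / 64)) Filter.atTop Filter.atTop :=
    (tendsto_rpow_atTop hρ).comp (Filter.tendsto_id.atTop_div_const (by norm_num))
  have hlog : ∀ᶠ N : ℝ in Filter.atTop, Real.log N ^ 2 ≤ (N / 2) ^ (γ / 64) := by
    have h := ((isLittleO_log_rpow_rpow_atTop (s := γ / 64) 2 hρ).bound
      (show (0 : ℝ) < ((2 : ℝ) ^ (γ / 64))⁻¹ by positivity))
    filter_upwards [h, Filter.eventually_ge_atTop 1] with N hN hN1
    rw [Real.rpow_two, Real.norm_of_nonneg (sq_nonneg _),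
      Real.norm_of_nonneg (by positivity)] at hN
    rwa [Real.div_rpow (by linarith) (by norm_num), div_eq_inv_mul]
  have hlog' : ∀ᶠ N : ℝ in Filter.atTop, 112 ≤ Real.log N :=
    Real.tendsto_log_atTop.eventually_ge_atTop 112
  filter_upwards [htop.eventually_ge_atTop 100, htop.eventually_ge_atTop (48 / (c - 1)), hlog,
    hlog', Filter.eventually_ge_atTop 1] with N h100 hyc hlogN hlarge hN1
  rintro η X X₁ rfl rfl rfl
  have hL : 0 < Real.log N ^ 2 := by positivity
  refine card_near_integer_powers_le hc1 hc2 h100 hyc ?_ ?_ ?_ _ ?_ ?_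
  · rw [← Real.rpow_natCast, ← Real.rpow_mul (by linarith)]
    congr 1
    push_cast
    ring
  · rw [one_div]
    gcongr
  · rw [one_div]
    gcongr
    nlinarith
  · intro m hm
    have hm' := Finset.mem_Ioc.1 (Finset.mem_filter.1 hm).1
    exact ⟨Int.floor_lt.1 hm'.1, Int.le_floor.1 hm'.2⟩
  · exact fun m hm => (Finset.mem_filter.1 hm).2
end
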